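/- arXiv:2103.12931 — 2 statements merged into one kernel-verified Lean document; each statement's English description precedes it below -/
import Mathlib

section
/- Let (x*,λ*) be a saddle point of L, assume the scaling condition holds, and let (x,λ) be a global solution of the perturbed primal-dual dynamical system. Then the trajectory (x(t),λ(t)) is bounded on [t₀,∞), ∫_{t₀}^{∞} (β(t)/δ − β̇(t)) · (L^σ(x(t),λ*) − L^σ(x*,λ(t))) dt < +∞, ∫_{t₀}^{∞} β(t)‖Ax(t) − b‖² dt < +∞, and ∫_{t₀}^{∞} ‖ẋ(t)‖² dt < +∞. -/
open scoped RealInnerProductSpace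
open MeasureTheory Set

noncomputable def Lagr {n m : ℕ} (f : EuclideanSpace ℝ (Fin n) → ℝ)
    (A : EuclideanSpace ℝ (Fin n) →L[ℝ] EuclideanSpace ℝ (Fin m))
    (b : EuclideanSpace ℝ (Fin m))
    (x : EuclideanSpace ℝ (Fin n)) (lam : EuclideanSpace ℝ (Fin m)) : ℝ :=
  f x + ⟪lam, A x - b⟫

noncomputable def AugLagr {n m : ℕ} (f : EuclideanSpace ℝ (Fin n) → ℝ)
    (A : EuclideanSpace ℝ (Fin n) →L[ℝ] EuclideanSpace ℝ (Fin m))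
    (b : EuclideanSpace ℝ (Fin m)) (σ : ℝ)
    (x : EuclideanSpace ℝ (Fin n)) (lam : EuclideanSpace ℝ (Fin m)) : ℝ :=
  Lagr f A b x lam + σ / 2 * ‖A x - b‖ ^ 2

def IsSaddlePoint {n m : ℕ} (f : EuclideanSpace ℝ (Fin n) → ℝ)
    (A : EuclideanSpace ℝ (Fin n) →L[ℝ] EuclideanSpace ℝ (Fin m))
    (b : EuclideanSpace ℝ (Fin m))
    (xs : EuclideanSpace ℝ (Fin n)) (ls : EuclideanSpace ℝ (Fin m)) : Prop :=
  ∀ x lam, Lagr f A b xs lam ≤ Lagr f A b xs ls ∧ Lagr f A b xs ls ≤ Lagr f A b x ls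

/-- Gronwall estimate with dissipation: if `W ≥ 0` satisfies `W' ≤ -D + e W` with `D, e ≥ 0` and
`e` integrable, then `W` is bounded above and `D` is integrable. -/
theorem bddAbove_and_integrableOn_of_deriv_le {t₀ : ℝ} {W W' D e : ℝ → ℝ}
    (hW : ∀ t ∈ Ici t₀, HasDerivWithinAt W (W' t) (Ici t₀) t)
    (hW₀ : ∀ t ∈ Ici t₀, 0 ≤ W t)
    (hD : ContinuousOn D (Ici t₀)) (hD₀ : ∀ t ∈ Ici t₀, 0 ≤ D t)
    (he : ContinuousOn e (Ici t₀)) (he₀ : ∀ t ∈ Ici t₀, 0 ≤ e t)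
    (heint : IntegrableOn e (Ici t₀))
    (hle : ∀ t ∈ Ici t₀, W' t ≤ -D t + e t * W t) :
    (∃ C, ∀ t ∈ Ici t₀, W t ≤ C) ∧ IntegrableOn D (Ici t₀) := by
  have hproj : Continuous fun t : ℝ => max t₀ t := by fun_prop
  have hmem : ∀ t, max t₀ t ∈ Ici t₀ := fun t => mem_Ici.2 (le_max_left t₀ t)
  have hec : Continuous fun t => e (max t₀ t) := he.comp_continuous hproj hmem
  have hDc : Continuous fun t => D (max t₀ t) := hD.comp_continuous hproj hmem
  let I : ℝ → ℝ := fun t => ∫ s in t₀..t, e (max t₀ s)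
  let J : ℝ → ℝ := fun t => ∫ s in t₀..t, D (max t₀ s)
  let M : ℝ := ∫ s in Ici t₀, e s
  have hI : ∀ t, HasDerivAt I (e (max t₀ t)) t := fun t =>
    intervalIntegral.integral_hasDerivAt_right (hec.intervalIntegrable _ _)
      (hec.stronglyMeasurableAtFilter _ _) hec.continuousAt
  have hJ : ∀ t, HasDerivAt J (D (max t₀ t)) t := fun t =>
    intervalIntegral.integral_hasDerivAt_right (hDc.intervalIntegrable _ _)
      (hDc.stronglyMeasurableAtFilter _ _) hDc.continuousAt
  have hIM : ∀ t ∈ Ici t₀, I t ≤ M := by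
    intro t ht
    have h1 : I t = ∫ s in Ioc t₀ t, e s := by
      simp only [I]
      rw [intervalIntegral.integral_of_le ht]
      refine setIntegral_congr_fun measurableSet_Ioc fun s hs => ?_
      simp [max_eq_right hs.1.le]
    rw [h1]
    refine setIntegral_mono_set heint ?_ (Filter.Eventually.of_forall fun s hs => hs.1.le)
    exact (ae_restrict_mem measurableSet_Ici).mono fun s hs => he₀ s hs
  have hJ₀ : ∀ t ∈ Ici t₀, 0 ≤ J t := fun t ht =>
    intervalIntegral.integral_nonneg ht fun s _ => hD₀ _ (hmem s)
  let Φ : ℝ → ℝ := fun t => W t * Real.exp (-I t) + Real.exp (-M) * J t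
  have hΦ : ∀ t ∈ Ici t₀, HasDerivWithinAt Φ
      (W' t * Real.exp (-I t) + W t * (Real.exp (-I t) * -e (max t₀ t))
        + Real.exp (-M) * D (max t₀ t)) (Ici t₀) t := fun t ht =>
    ((hW t ht).mul (hI t).neg.exp.hasDerivWithinAt).add
      ((hJ t).const_mul _).hasDerivWithinAt
  have hanti : AntitoneOn Φ (Ici t₀) := by
    refine antitoneOn_of_hasDerivWithinAt_nonpos (convex_Ici t₀)
      (fun t ht => (hΦ t ht).continuousWithinAt)
      (fun t ht => (hΦ t (interior_subset ht)).mono interior_subset) fun t ht => ?_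
    have ht' : t ∈ Ici t₀ := interior_subset ht
    rw [max_eq_right ht']
    have hexp : Real.exp (-M) ≤ Real.exp (-I t) := Real.exp_le_exp.2 (neg_le_neg (hIM t ht'))
    have h1 := mul_le_mul_of_nonneg_right hexp (hD₀ t ht')
    have h2 := mul_le_mul_of_nonneg_right (hle t ht') (Real.exp_pos (-I t)).le
    linarith
  have hΦle : ∀ t ∈ Ici t₀, Φ t ≤ W t₀ := by
    intro t ht
    have h := hanti self_mem_Ici ht ht
    simpa [Φ, I, J] using h
  refine ⟨⟨W t₀ * Real.exp M, fun t ht => ?_⟩, ?_⟩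
  · have h1 : W t * Real.exp (-M) ≤ W t₀ := by
      refine le_trans ?_ (hΦle t ht)
      have hexp : Real.exp (-M) ≤ Real.exp (-I t) := Real.exp_le_exp.2 (neg_le_neg (hIM t ht))
      have h2 := mul_le_mul_of_nonneg_left hexp (hW₀ t ht)
      have h3 := mul_nonneg (Real.exp_pos (-M)).le (hJ₀ t ht)
      simp only [Φ]
      linarith
    rw [Real.exp_neg, ← div_eq_mul_inv] at h1
    exact (div_le_iff₀ (Real.exp_pos M)).1 h1
  · rw [integrableOn_Ici_iff_integrableOn_Ioi]
    refine integrableOn_Ioi_of_intervalIntegral_norm_bounded (W t₀ * Real.exp M) t₀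
      (l := Filter.atTop) (b := id) (fun t => ?_) Filter.tendsto_id ?_
    · exact ((hD.mono Icc_subset_Ici_self).integrableOn_Icc).mono_set Ioc_subset_Icc_self
    · filter_upwards [Filter.eventually_ge_atTop t₀] with t ht
      have h1 : ∫ s in t₀..id t, ‖D s‖ = J t := by
        refine intervalIntegral.integral_congr fun s hs => ?_
        rw [id, uIcc_of_le ht] at hs
        simp [max_eq_right hs.1, abs_of_nonneg (hD₀ s hs.1)]
      have h2 : J t * Real.exp (-M) ≤ W t₀ := by
        refine le_trans ?_ (hΦle t ht)
        have h3 := mul_nonneg (hW₀ t ht) (Real.exp_pos (-I t)).le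
        simp only [Φ]
        linarith
      rw [h1]
      rw [Real.exp_neg, ← div_eq_mul_inv] at h2
      exact (div_le_iff₀ (Real.exp_pos M)).1 h2

/-- A differentiable convex function lies above its tangent planes. -/
theorem ConvexOn.add_inner_gradient_le {F : Type*} [NormedAddCommGroup F] [InnerProductSpace ℝ F]
    [CompleteSpace F] {f : F → ℝ} (hf : ConvexOn ℝ univ f) {x : F}
    (hd : DifferentiableAt ℝ f x) (y : F) : f x + ⟪gradient f x, y - x⟫ ≤ f y := by
  have hconv : ConvexOn ℝ univ (f ∘ AffineMap.lineMap (k := ℝ) x y) := by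
    simpa using hf.comp_affineMap (AffineMap.lineMap (k := ℝ) x y)
  have hderiv : HasDerivAt (f ∘ AffineMap.lineMap (k := ℝ) x y) ⟪gradient f x, y - x⟫ 0 := by
    have h1 : HasFDerivAt f (InnerProductSpace.toDual ℝ F (gradient f x))
        (AffineMap.lineMap (k := ℝ) x y 0) := by
      rw [AffineMap.lineMap_apply_zero]
      exact hd.hasGradientAt.hasFDerivAt
    exact h1.comp_hasDerivAt 0 AffineMap.hasDerivAt_lineMap
  have h := hconv.le_slope_of_hasDerivAt (mem_univ 0) (mem_univ 1) zero_lt_one hderiv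
  simp only [slope_def_field, Function.comp_apply, AffineMap.lineMap_apply_zero,
    AffineMap.lineMap_apply_one, sub_zero, div_one] at h
  linarith

theorem IsSaddlePoint.apply_eq {n m : ℕ} {f : EuclideanSpace ℝ (Fin n) → ℝ}
    {A : EuclideanSpace ℝ (Fin n) →L[ℝ] EuclideanSpace ℝ (Fin m)}
    {b : EuclideanSpace ℝ (Fin m)}
    {xs : EuclideanSpace ℝ (Fin n)} {ls : EuclideanSpace ℝ (Fin m)}
    (h : IsSaddlePoint f A b xs ls) : A xs = b := by
  have h1 := (h xs (ls + (A xs - b))).1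
  simp only [Lagr, inner_add_left, real_inner_self_eq_norm_sq] at h1
  have h2 : ‖A xs - b‖ ^ 2 = 0 := le_antisymm (by linarith) (sq_nonneg _)
  exact sub_eq_zero.1 (norm_eq_zero.1 (pow_eq_zero_iff two_ne_zero |>.1 h2))

theorem perturbed_boundedness_and_integrals
    {n m : ℕ}
    (f : EuclideanSpace ℝ (Fin n) → ℝ)
    (hf_conv : ConvexOn ℝ Set.univ f)
    (hf_smooth : ContDiff ℝ 1 f)
    (A : EuclideanSpace ℝ (Fin n) →L[ℝ] EuclideanSpace ℝ (Fin m))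
    (b : EuclideanSpace ℝ (Fin m))
    (t₀ γ δ σ : ℝ) (ht₀ : 0 ≤ t₀) (hγ : 0 < γ) (hδ : 0 < δ) (hσ : 0 < σ)
    (β β' : ℝ → ℝ)
    (hβpos : ∀ t ∈ Ici t₀, 0 < β t)
    (hβderiv : ∀ t ∈ Ici t₀, HasDerivWithinAt β (β' t) (Ici t₀) t)
    (hβ'cont : ContinuousOn β' (Ici t₀))
    (xs : EuclideanSpace ℝ (Fin n)) (ls : EuclideanSpace ℝ (Fin m))
    (hsaddle : IsSaddlePoint f A b xs ls)
    (hscale : ∀ t ∈ Ici t₀, β' t ≤ β t / δ) (hscale' : 1 / δ < γ)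
    (ε : ℝ → EuclideanSpace ℝ (Fin n))
    (hεcont : ContinuousOn ε (Ici t₀))
    (hεint : IntegrableOn (fun t => ‖ε t‖) (Ici t₀))
    (x x' x'' : ℝ → EuclideanSpace ℝ (Fin n))
    (lam lam' : ℝ → EuclideanSpace ℝ (Fin m))
    (hx : ∀ t ∈ Ici t₀, HasDerivWithinAt x (x' t) (Ici t₀) t)
    (hx' : ∀ t ∈ Ici t₀, HasDerivWithinAt x' (x'' t) (Ici t₀) t)
    (hx''cont : ContinuousOn x'' (Ici t₀))
    (hlam : ∀ t ∈ Ici t₀, HasDerivWithinAt lam (lam' t) (Ici t₀) t)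
    (hlam'cont : ContinuousOn lam' (Ici t₀))
    (hode1 : ∀ t ∈ Ici t₀, x'' t + γ • x' t =
      -(β t) • (gradient f (x t) + A.adjoint (lam t) + σ • A.adjoint (A (x t) - b)) + ε t)
    (hode2 : ∀ t ∈ Ici t₀, lam' t = β t • (A (x t + δ • x' t) - b))
    :
    (∃ C : ℝ, ∀ t ∈ Ici t₀, ‖x t‖ ≤ C ∧ ‖lam t‖ ≤ C) ∧
    IntegrableOn (fun t => (β t / δ - β' t) *
      (AugLagr f A b σ (x t) ls - AugLagr f A b σ xs (lam t))) (Ici t₀) ∧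
    IntegrableOn (fun t => β t * ‖A (x t) - b‖ ^ 2) (Ici t₀) ∧
    IntegrableOn (fun t => ‖x' t‖ ^ 2) (Ici t₀) := by
  have hAxs : A xs = b := hsaddle.apply_eq
  have hfd : Differentiable ℝ f := hf_smooth.differentiable one_ne_zero
  have hAx : ∀ z, A (z - xs) = A z - b := fun z => by rw [map_sub, hAxs]
  set c : ℝ := 1 / δ with hc
  have hc₀ : 0 < c := by positivity
  have hcδ : c * δ = 1 := by rw [hc]; field_simp
  have hγc : 0 < γ - c := sub_pos.2 hscale'
  let G : ℝ → ℝ := fun t => AugLagr f A b σ (x t) ls - AugLagr f A b σ xs (lam t)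
  have hGdef : ∀ t, G t = f (x t) + ⟪ls, A (x t) - b⟫ + σ / 2 * ‖A (x t) - b‖ ^ 2 - f xs := by
    intro t
    simp [G, AugLagr, Lagr, hAxs]
  have hG₀ : ∀ t, 0 ≤ G t := by
    intro t
    have h1 := (hsaddle (x t) ls).2
    simp only [Lagr, hAxs, sub_self, inner_zero_right, add_zero] at h1
    have h2 : 0 ≤ σ / 2 * ‖A (x t) - b‖ ^ 2 := by positivity
    rw [hGdef]
    linarith
  have hrd : ∀ t ∈ Ici t₀, HasDerivWithinAt (fun t => A (x t) - b) (A (x' t)) (Ici t₀) t :=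
    fun t ht => (A.hasFDerivAt.comp_hasDerivWithinAt t (hx t ht)).sub_const b
  have hGd : ∀ t ∈ Ici t₀, HasDerivWithinAt G
      (⟪gradient f (x t), x' t⟫ + ⟪ls, A (x' t)⟫ + σ * ⟪A (x t) - b, A (x' t)⟫) (Ici t₀) t := by
    intro t ht
    have h1 : HasDerivWithinAt (fun t => f (x t)) ⟪gradient f (x t), x' t⟫ (Ici t₀) t :=
      (hfd (x t)).hasGradientAt.hasFDerivAt.comp_hasDerivWithinAt t (hx t ht)
    have h2 := (hasDerivWithinAt_const t (Ici t₀) ls).inner ℝ (hrd t ht)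
    have h3 := ((hrd t ht).norm_sq).const_mul (σ / 2)
    have h4 := ((h1.add h2).add h3).sub_const (f xs)
    rw [show G = _ from funext hGdef]
    refine h4.congr_deriv ?_
    rw [inner_zero_left]
    ring
  let u : ℝ → EuclideanSpace ℝ (Fin n) := fun t => c • (x t - xs) + x' t
  let W : ℝ → ℝ := fun t => β t * G t + 1 / 2 * ‖u t‖ ^ 2
    + c * (γ - c) / 2 * ‖x t - xs‖ ^ 2 + c / 2 * ‖lam t - ls‖ ^ 2 + 1 / 2
  let D : ℝ → ℝ := fun t => (β t / δ - β' t) * G t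
    + c * σ / 2 * (β t * ‖A (x t) - b‖ ^ 2) + (γ - c) * ‖x' t‖ ^ 2
  have hD₁ : ∀ t ∈ Ici t₀, 0 ≤ (β t / δ - β' t) * G t := fun t ht =>
    mul_nonneg (sub_nonneg.2 (hscale t ht)) (hG₀ t)
  have hD₂ : ∀ t ∈ Ici t₀, 0 ≤ β t * ‖A (x t) - b‖ ^ 2 := fun t ht =>
    mul_nonneg (hβpos t ht).le (sq_nonneg _)
  have hW₁ : ∀ t ∈ Ici t₀, 0 ≤ β t * G t := fun t ht => mul_nonneg (hβpos t ht).le (hG₀ t)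
  have hcγ : 0 < c * (γ - c) / 2 := by positivity
  have hud : ∀ t ∈ Ici t₀, HasDerivWithinAt u (c • x' t + x'' t) (Ici t₀) t := fun t ht =>
    (((hx t ht).sub_const xs).const_smul c).add (hx' t ht)
  have hWd : ∀ t ∈ Ici t₀, HasDerivWithinAt W
      (β' t * G t + β t * (⟪gradient f (x t), x' t⟫ + ⟪ls, A (x' t)⟫
          + σ * ⟪A (x t) - b, A (x' t)⟫)
        + 1 / 2 * (2 * ⟪u t, c • x' t + x'' t⟫)
        + c * (γ - c) / 2 * (2 * ⟪x t - xs, x' t⟫)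
        + c / 2 * (2 * ⟪lam t - ls, lam' t⟫)) (Ici t₀) t := fun t ht =>
    (((((hβderiv t ht).mul (hGd t ht)).add ((hud t ht).norm_sq.const_mul _)).add
      (((hx t ht).sub_const xs).norm_sq.const_mul _)).add
      (((hlam t ht).sub_const ls).norm_sq.const_mul _)).add_const _
  have hβc : ContinuousOn β (Ici t₀) := fun t ht => (hβderiv t ht).continuousWithinAt
  have hGc : ContinuousOn G (Ici t₀) := fun t ht => (hGd t ht).continuousWithinAt
  have hrc : ContinuousOn (fun t => A (x t) - b) (Ici t₀) :=
    fun t ht => (hrd t ht).continuousWithinAt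
  have hx'c : ContinuousOn x' (Ici t₀) := fun t ht => (hx' t ht).continuousWithinAt
  have hDc₁ : ContinuousOn (fun t => (β t / δ - β' t) * G t) (Ici t₀) :=
    ((hβc.div_const δ).sub hβ'cont).mul hGc
  have hDc₂ : ContinuousOn (fun t => β t * ‖A (x t) - b‖ ^ 2) (Ici t₀) :=
    hβc.mul (hrc.norm.pow 2)
  have hDc₃ : ContinuousOn (fun t => ‖x' t‖ ^ 2) (Ici t₀) := hx'c.norm.pow 2
  have hDc : ContinuousOn D (Ici t₀) :=
    (hDc₁.add (hDc₂.const_mul _)).add (hDc₃.const_mul _)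
  have hD₀ : ∀ t ∈ Ici t₀, 0 ≤ D t := fun t ht =>
    add_nonneg (add_nonneg (hD₁ t ht) (mul_nonneg (by positivity) (hD₂ t ht)))
      (mul_nonneg hγc.le (sq_nonneg _))
  have hW₀ : ∀ t ∈ Ici t₀, 0 ≤ W t := fun t ht => by
    have := hW₁ t ht
    simp only [W]
    positivity
  obtain ⟨⟨C, hC⟩, hDint⟩ := bddAbove_and_integrableOn_of_deriv_le hWd hW₀ hDc hD₀
    hεcont.norm (fun t _ => norm_nonneg (ε t)) hεint (fun t ht => by
      have hβt := hβpos t ht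
      have hεu : ⟪u t, ε t⟫ ≤ ‖ε t‖ * W t := by
        have h1 : ‖u t‖ ≤ W t := by
          have h2 := hW₁ t ht
          have h3 : 0 ≤ c * (γ - c) / 2 * ‖x t - xs‖ ^ 2 := by positivity
          have h4 : 0 ≤ c / 2 * ‖lam t - ls‖ ^ 2 := by positivity
          simp only [W]
          linarith [sq_nonneg (‖u t‖ - 1)]
        calc ⟪u t, ε t⟫ ≤ ‖u t‖ * ‖ε t‖ := real_inner_le_norm _ _
          _ ≤ W t * ‖ε t‖ := by gcongr
          _ = ‖ε t‖ * W t := mul_comm _ _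
      have hconv : G t + σ / 2 * ‖A (x t) - b‖ ^ 2 ≤ ⟪gradient f (x t), x t - xs⟫
          + ⟪ls, A (x t) - b⟫ + σ * ‖A (x t) - b‖ ^ 2 := by
        have h1 := hf_conv.add_inner_gradient_le (hfd (x t)) xs
        rw [← neg_sub (x t) xs, inner_neg_right] at h1
        rw [hGdef]
        linarith
      have hconv' := mul_le_mul_of_nonneg_left hconv (mul_pos hc₀ hβt).le
      have hacc : x'' t = -(β t) • (gradient f (x t) + A.adjoint (lam t)
          + σ • A.adjoint (A (x t) - b)) + ε t - γ • x' t := eq_sub_of_add_eq (hode1 t ht)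
      have hinner : ∀ z, ⟪z, x'' t⟫ = -(β t) * (⟪gradient f (x t), z⟫ + ⟪lam t, A z⟫
          + σ * ⟪A (x t) - b, A z⟫) + ⟪z, ε t⟫ - γ * ⟪z, x' t⟫ := by
        intro z
        rw [hacc, inner_sub_right, inner_add_right, inner_smul_right, inner_smul_right,
          inner_add_right, inner_add_right, inner_smul_right,
          ContinuousLinearMap.adjoint_inner_right, ContinuousLinearMap.adjoint_inner_right,
          real_inner_comm z, real_inner_comm (A z), real_inner_comm (A z)]
      have hlam' : ⟪lam t - ls, lam' t⟫ = β t * (⟪lam t, A (x t) - b⟫ + δ * ⟪lam t, A (x' t)⟫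
          - ⟪ls, A (x t) - b⟫ - δ * ⟪ls, A (x' t)⟫) := by
        rw [hode2 t ht, map_add, map_smul, add_sub_right_comm, inner_smul_right,
          inner_add_right, inner_smul_right, inner_sub_left, inner_sub_left]
        ring
      have hu : ⟪u t, c • x' t + x'' t⟫ = c * (c * ⟪x t - xs, x' t⟫ + ⟪x t - xs, x'' t⟫)
          + c * ‖x' t‖ ^ 2 + ⟪x' t, x'' t⟫ := by
        simp only [u, inner_add_left, inner_add_right, real_inner_smul_left,
          real_inner_smul_right, real_inner_self_eq_norm_sq]
        ring
      have huε : ⟪u t, ε t⟫ = c * ⟪x t - xs, ε t⟫ + ⟪x' t, ε t⟫ := by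
        simp only [u, inner_add_left, real_inner_smul_left]
      rw [huε] at hεu
      have hdiv : β t / δ = c * β t := by rw [hc]; ring
      rw [hu, hinner, hinner, hlam', hAx, real_inner_self_eq_norm_sq, real_inner_self_eq_norm_sq]
      simp only [D, hdiv]
      linear_combination hεu + hconv'
        + β t * (⟪lam t, A (x' t)⟫ - ⟪ls, A (x' t)⟫) * hcδ)
  have hint : ∀ {g : ℝ → ℝ} {k : ℝ}, 0 < k → ContinuousOn g (Ici t₀) →
      (∀ t ∈ Ici t₀, 0 ≤ g t ∧ k * g t ≤ D t) → IntegrableOn g (Ici t₀) := by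
    intro g k hk hg hle
    refine (hDint.const_mul k⁻¹).mono' (hg.aestronglyMeasurable measurableSet_Ici) ?_
    filter_upwards [ae_restrict_mem measurableSet_Ici] with t ht
    rw [Real.norm_of_nonneg (hle t ht).1, ← div_eq_inv_mul, le_div_iff₀ hk, mul_comm]
    exact (hle t ht).2
  refine ⟨⟨max (‖xs‖ + √(C / (c * (γ - c) / 2))) (‖ls‖ + √(C / (c / 2))), fun t ht => ?_⟩,
    hint one_pos hDc₁ fun t ht => ⟨hD₁ t ht, ?_⟩,
    hint (k := c * σ / 2) (by positivity) hDc₂ fun t ht => ⟨hD₂ t ht, ?_⟩,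
    hint hγc hDc₃ fun t ht => ⟨sq_nonneg _, ?_⟩⟩
  · have hWC := hC t ht
    have h₁ := hW₁ t ht
    have h₂ : 0 ≤ c * (γ - c) / 2 * ‖x t - xs‖ ^ 2 := by positivity
    have h₃ : 0 ≤ c / 2 * ‖lam t - ls‖ ^ 2 := by positivity
    have h₄ := sq_nonneg ‖u t‖
    simp only [W] at hWC
    constructor
    · refine le_max_of_le_left ((norm_le_norm_add_norm_sub' (x t) xs).trans ?_)
      gcongr
      refine Real.le_sqrt_of_sq_le ((le_div_iff₀ hcγ).2 ?_)
      linarith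
    · refine le_max_of_le_right ((norm_le_norm_add_norm_sub' (lam t) ls).trans ?_)
      gcongr
      refine Real.le_sqrt_of_sq_le ((le_div_iff₀ (half_pos hc₀)).2 ?_)
      linarith
  all_goals
    have h₁ := hD₁ t ht
    have h₂ := mul_nonneg (show 0 ≤ c * σ / 2 by positivity) (hD₂ t ht)
    have h₃ := mul_nonneg hγc.le (sq_nonneg ‖x' t‖)
    simp only [D]
    linarith
end

section
/- Let (x*,λ*) be a saddle point of L, assume the scaling condition holds, and let (x,λ) be a global solution of the perturbed primal-dual dynamical system. Then there exist constants C₁, C₂ ≥ 0 such that L(x(t),λ*) − L(x*,λ(t)) ≤ C₁/β(t) and ‖Ax(t) − b‖ ≤ C₂/√β(t) for all t ≥ t₀; in particular, if lim_{t→∞} β(t) = +∞, then L(x(t),λ*) − L(x*,λ(t)) = O(1/β(t)) and ‖Ax(t) − b‖ = O(1/√β(t)) as t → ∞. -/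
open scoped RealInnerProductSpace
open MeasureTheory Set

/-- The first-order characterisation of a differentiable convex function. -/
theorem ConvexOn.inner_gradient_le_sub {H : Type*} [NormedAddCommGroup H] [InnerProductSpace ℝ H]
    [CompleteSpace H] {f : H → ℝ} (hf : ConvexOn ℝ univ f) {x : H}
    (hd : DifferentiableAt ℝ f x) (y : H) :
    ⟪gradient f x, y - x⟫ ≤ f y - f x := by
  have hconv : ConvexOn ℝ univ (f ∘ AffineMap.lineMap (k := ℝ) x y) := by
    simpa using hf.comp_affineMap (AffineMap.lineMap (k := ℝ) x y)
  have hfd : HasFDerivAt f (InnerProductSpace.toDual ℝ H (gradient f x))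
      (AffineMap.lineMap (k := ℝ) x y (0 : ℝ)) := by
    simpa using hd.hasGradientAt.hasFDerivAt
  have hline : HasDerivAt (f ∘ AffineMap.lineMap (k := ℝ) x y) ⟪gradient f x, y - x⟫ 0 := by
    simpa only [InnerProductSpace.toDual_apply_apply] using
      hfd.comp_hasDerivAt (0 : ℝ) AffineMap.hasDerivAt_lineMap
  simpa [slope] using
    hconv.le_slope_of_hasDerivAt (mem_univ (0 : ℝ)) (mem_univ (1 : ℝ)) one_pos hline

/-- A linear Grönwall bound on a half-line with an integrable coefficient. -/
theorem exists_bound_of_hasDerivWithinAt_le_mul_one_add {t₀ : ℝ} {E E' e : ℝ → ℝ}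
    (hE : ∀ t ∈ Ici t₀, HasDerivWithinAt E (E' t) (Ici t₀) t)
    (hE0 : ∀ t ∈ Ici t₀, 0 ≤ E t) (he : ContinuousOn e (Ici t₀))
    (he0 : ∀ t ∈ Ici t₀, 0 ≤ e t) (heint : IntegrableOn e (Ici t₀))
    (hle : ∀ t ∈ Ici t₀, E' t ≤ e t * (1 + E t)) :
    ∃ M, 0 ≤ M ∧ ∀ t ∈ Ici t₀, E t ≤ M := by
  set u : ℝ → ℝ := fun s => e (max s t₀)
  have hu_cont : Continuous u :=
    he.comp_continuous (continuous_id.max continuous_const) fun s => le_max_right s t₀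
  have hu_eq : ∀ t ∈ Ici t₀, u t = e t := fun t ht => congrArg e (max_eq_left ht)
  set I : ℝ → ℝ := fun t => ∫ s in t₀..t, u s with hI
  have hI_deriv : ∀ t, HasDerivAt I (u t) t := fun t =>
    (hu_cont.integral_hasStrictDerivAt t₀ t).hasDerivAt
  have hI_le : ∀ t ∈ Ici t₀, I t ≤ ∫ s in Ici t₀, e s := by
    intro t ht
    simp only [hI]
    rw [intervalIntegral.integral_of_le ht,
      setIntegral_congr_fun measurableSet_Ioc fun s hs => hu_eq s hs.1.le]
    exact setIntegral_mono_set heint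
      ((ae_restrict_iff' measurableSet_Ici).2 (Filter.Eventually.of_forall he0))
      (Filter.Eventually.of_forall fun s hs => hs.1.le)
  have hderiv : ∀ t ∈ Ici t₀, HasDerivWithinAt (fun t => (1 + E t) * Real.exp (-I t))
      ((E' t - u t * (1 + E t)) * Real.exp (-I t)) (Ici t₀) t := by
    intro t ht
    refine (((hE t ht).const_add 1).mul
      (hI_deriv t).fun_neg.exp.hasDerivWithinAt).congr_deriv ?_
    ring
  have hanti : AntitoneOn (fun t => (1 + E t) * Real.exp (-I t)) (Ici t₀) := by
    refine antitoneOn_of_hasDerivWithinAt_nonpos (convex_Ici t₀)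
      (fun t ht => (hderiv t ht).continuousWithinAt)
      (fun t ht => (hderiv t (interior_subset ht)).mono interior_subset) fun t ht => ?_
    have ht' := interior_subset ht
    rw [hu_eq t ht']
    exact mul_nonpos_of_nonpos_of_nonneg (sub_nonpos.2 (hle t ht')) (Real.exp_pos _).le
  have hE0' := hE0 t₀ self_mem_Ici
  refine ⟨(1 + E t₀) * Real.exp (∫ s in Ici t₀, e s), by positivity, fun t ht => ?_⟩
  have h1 := hanti self_mem_Ici ht ht
  have h2 : I t₀ = 0 := intervalIntegral.integral_same
  simp only [h2, neg_zero, Real.exp_zero, mul_one] at h1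
  have h3 : 1 + E t ≤ (1 + E t₀) * Real.exp (I t) := by
    rwa [Real.exp_neg, ← div_eq_mul_inv, div_le_iff₀ (Real.exp_pos _)] at h1
  have h4 : (1 + E t₀) * Real.exp (I t) ≤ (1 + E t₀) * Real.exp (∫ s in Ici t₀, e s) := by
    gcongr
    exact hI_le t ht
  linarith

section Saddle

variable {n m : ℕ} {f : EuclideanSpace ℝ (Fin n) → ℝ}
  {A : EuclideanSpace ℝ (Fin n) →L[ℝ] EuclideanSpace ℝ (Fin m)}
  {b : EuclideanSpace ℝ (Fin m)} {xs : EuclideanSpace ℝ (Fin n)} {ls : EuclideanSpace ℝ (Fin m)}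

theorem IsSaddlePoint.feasible (h : IsSaddlePoint f A b xs ls) : A xs = b := by
  have h1 := (h xs (ls + (A xs - b))).1
  simp only [Lagr, inner_add_left] at h1
  have h2 : ⟪A xs - b, A xs - b⟫ ≤ 0 := by linarith
  rw [real_inner_self_eq_norm_sq] at h2
  exact sub_eq_zero.1 (norm_eq_zero.1 (pow_eq_zero_iff two_ne_zero |>.1 <|
    h2.antisymm (sq_nonneg _)))

theorem IsSaddlePoint.lagr_eq (h : IsSaddlePoint f A b xs ls) (lam : EuclideanSpace ℝ (Fin m)) :
    Lagr f A b xs lam = f xs := by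
  simp [Lagr, h.feasible]

theorem IsSaddlePoint.lagr_sub_nonneg (h : IsSaddlePoint f A b xs ls)
    (x : EuclideanSpace ℝ (Fin n)) : 0 ≤ Lagr f A b x ls - f xs := by
  have := (h x ls).2
  rw [h.lagr_eq] at this
  linarith

end Saddle

/-- The derivative of the Lyapunov function along the primal-dual dynamics: `g` is the gradient of
the objective, `y` and `v` are the position relative to the minimiser and the velocity, and `l` and
`ls` are the current and the optimal multiplier. -/
theorem energy_deriv_identity {H K : Type*} [NormedAddCommGroup H] [InnerProductSpace ℝ H]
    [CompleteSpace H] [NormedAddCommGroup K] [InnerProductSpace ℝ K] [CompleteSpace K]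
    (A : H →L[ℝ] K) (g y v a e : H) (l ls l' : K) (γ δ σ β β' φ : ℝ)
    (ha : a + γ • v = -β • (g + A.adjoint l + σ • A.adjoint (A y)) + e)
    (hl' : l' = β • A (y + δ • v)) :
    δ ^ 2 * (β' * (φ + ⟪ls, A y⟫ + σ / 2 * ‖A y‖ ^ 2)
        + β * (⟪g, v⟫ + ⟪ls, A v⟫ + σ / 2 * (2 * ⟪A y, A v⟫)))
      + 1 / 2 * (2 * ⟪y + δ • v, v + δ • a⟫)
      + (δ * γ - 1) / 2 * (2 * ⟪y, v⟫)
      + δ / 2 * (2 * ⟪l - ls, l'⟫)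
    = δ * (δ * β' - β) * (φ + ⟪ls, A y⟫ + σ / 2 * ‖A y‖ ^ 2)
      - δ * (δ * γ - 1) * ‖v‖ ^ 2 + δ * ⟪e, y + δ • v⟫
      - δ * β * (⟪g, y⟫ - φ + σ / 2 * ‖A y‖ ^ 2) := by
  have ha' : a = -β • (g + A.adjoint l + σ • A.adjoint (A y)) + e - γ • v := by
    rw [← ha, add_sub_cancel_right]
  rw [ha', hl']
  simp only [← real_inner_self_eq_norm_sq, inner_add_left, inner_add_right, inner_sub_left,
    inner_sub_right, real_inner_smul_left, real_inner_smul_right, map_add, map_smul,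
    ContinuousLinearMap.adjoint_inner_right]
  rw [real_inner_comm v y, real_inner_comm g y, real_inner_comm g v, real_inner_comm e y,
    real_inner_comm e v, real_inner_comm (A y) (A v), real_inner_comm l (A y),
    real_inner_comm l (A v)]
  ring

theorem perturbed_gap_and_feasibility_rates
    {n m : ℕ}
    (f : EuclideanSpace ℝ (Fin n) → ℝ)
    (hf_conv : ConvexOn ℝ Set.univ f)
    (hf_smooth : ContDiff ℝ 1 f)
    (A : EuclideanSpace ℝ (Fin n) →L[ℝ] EuclideanSpace ℝ (Fin m))
    (b : EuclideanSpace ℝ (Fin m))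
    (t₀ γ δ σ : ℝ) (ht₀ : 0 ≤ t₀) (hγ : 0 < γ) (hδ : 0 < δ) (hσ : 0 < σ)
    (β β' : ℝ → ℝ)
    (hβpos : ∀ t ∈ Ici t₀, 0 < β t)
    (hβderiv : ∀ t ∈ Ici t₀, HasDerivWithinAt β (β' t) (Ici t₀) t)
    (hβ'cont : ContinuousOn β' (Ici t₀))
    (xs : EuclideanSpace ℝ (Fin n)) (ls : EuclideanSpace ℝ (Fin m))
    (hsaddle : IsSaddlePoint f A b xs ls)
    (hscale : ∀ t ∈ Ici t₀, β' t ≤ β t / δ) (hscale' : 1 / δ < γ)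
    (ε : ℝ → EuclideanSpace ℝ (Fin n))
    (hεcont : ContinuousOn ε (Ici t₀))
    (hεint : IntegrableOn (fun t => ‖ε t‖) (Ici t₀))
    (x x' x'' : ℝ → EuclideanSpace ℝ (Fin n))
    (lam lam' : ℝ → EuclideanSpace ℝ (Fin m))
    (hx : ∀ t ∈ Ici t₀, HasDerivWithinAt x (x' t) (Ici t₀) t)
    (hx' : ∀ t ∈ Ici t₀, HasDerivWithinAt x' (x'' t) (Ici t₀) t)
    (hx''cont : ContinuousOn x'' (Ici t₀))
    (hlam : ∀ t ∈ Ici t₀, HasDerivWithinAt lam (lam' t) (Ici t₀) t)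
    (hlam'cont : ContinuousOn lam' (Ici t₀))
    (hode1 : ∀ t ∈ Ici t₀, x'' t + γ • x' t =
      -(β t) • (gradient f (x t) + A.adjoint (lam t) + σ • A.adjoint (A (x t) - b)) + ε t)
    (hode2 : ∀ t ∈ Ici t₀, lam' t = β t • (A (x t + δ • x' t) - b))
    :
    ∃ C₁ C₂ : ℝ, 0 ≤ C₁ ∧ 0 ≤ C₂ ∧ ∀ t ∈ Ici t₀,
      Lagr f A b (x t) ls - Lagr f A b xs (lam t) ≤ C₁ / β t ∧
      ‖A (x t) - b‖ ≤ C₂ / Real.sqrt (β t) := by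
  have hfeas := hsaddle.feasible
  have hAy : ∀ t, A (x t) - b = A (x t - xs) := fun t => by rw [map_sub, hfeas]
  have hδγ : 0 < δ * γ - 1 := by
    rw [div_lt_iff₀ hδ] at hscale'
    linarith
  set G : ℝ → ℝ := fun t =>
    (f (x t) - f xs) + ⟪ls, A (x t - xs)⟫ + σ / 2 * ‖A (x t - xs)‖ ^ 2 with hG
  have hgap : ∀ t, 0 ≤ (f (x t) - f xs) + ⟪ls, A (x t - xs)⟫ := fun t => by
    have := hsaddle.lagr_sub_nonneg (x t)
    rw [Lagr, hAy] at this
    linarith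
  have hG0 : ∀ t, 0 ≤ G t := fun t => add_nonneg (hgap t) (by positivity)
  set z : ℝ → EuclideanSpace ℝ (Fin n) := fun t => (x t - xs) + δ • x' t
  set E : ℝ → ℝ := fun t => δ ^ 2 * (β t * G t) + 1 / 2 * ‖z t‖ ^ 2
    + (δ * γ - 1) / 2 * ‖x t - xs‖ ^ 2 + δ / 2 * ‖lam t - ls‖ ^ 2 with hE
  have hβG : ∀ t ∈ Ici t₀, 0 ≤ β t * G t := fun t ht => mul_nonneg (hβpos t ht).le (hG0 t)
  have hE0 : ∀ t ∈ Ici t₀, 0 ≤ E t := fun t ht => by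
    have := hβG t ht
    positivity
  have hy : ∀ t ∈ Ici t₀, HasDerivWithinAt (fun t => x t - xs) (x' t) (Ici t₀) t :=
    fun t ht => (hx t ht).sub_const xs
  have hfd : Differentiable ℝ f := hf_smooth.differentiable one_ne_zero
  have hGd : ∀ t ∈ Ici t₀, HasDerivWithinAt G
      (⟪gradient f (x t), x' t⟫ + ⟪ls, A (x' t)⟫
        + σ / 2 * (2 * ⟪A (x t - xs), A (x' t)⟫)) (Ici t₀) t := by
    intro t ht
    have h1 : HasDerivWithinAt (f ∘ x) ⟪gradient f (x t), x' t⟫ (Ici t₀) t := by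
      simpa only [InnerProductSpace.toDual_apply_apply] using
        (hfd (x t)).hasGradientAt.hasFDerivAt.comp_hasDerivWithinAt t (hx t ht)
    have h2 : HasDerivWithinAt (fun t => A (x t - xs)) (A (x' t)) (Ici t₀) t :=
      A.hasFDerivAt.comp_hasDerivWithinAt t (hy t ht)
    have h3 : HasDerivWithinAt (fun t => ⟪ls, A (x t - xs)⟫) ⟪ls, A (x' t)⟫ (Ici t₀) t := by
      simpa using (hasDerivWithinAt_const t (Ici t₀) ls).inner ℝ h2
    exact ((h1.sub_const (f xs)).add h3).add (h2.norm_sq.const_mul (σ / 2))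
  have hEd : ∀ t ∈ Ici t₀, HasDerivWithinAt E
      (δ * (δ * β' t - β t) * G t
        - δ * (δ * γ - 1) * ‖x' t‖ ^ 2 + δ * ⟪ε t, z t⟫
        - δ * β t * (⟪gradient f (x t), x t - xs⟫ - (f (x t) - f xs)
          + σ / 2 * ‖A (x t - xs)‖ ^ 2)) (Ici t₀) t := by
    intro t ht
    have hode1' := hode1 t ht
    have hode2' := hode2 t ht
    rw [hAy] at hode1'
    have hA : A (x t + δ • x' t) - b = A (x t - xs + δ • x' t) := by
      rw [map_add, map_add, ← hAy]
      abel
    rw [hA] at hode2'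
    rw [← energy_deriv_identity A (gradient f (x t)) (x t - xs) (x' t) (x'' t) (ε t) (lam t) ls
      (lam' t) γ δ σ (β t) (β' t) (f (x t) - f xs) hode1' hode2']
    have hzd : HasDerivWithinAt z (x' t + δ • x'' t) (Ici t₀) t :=
      (hy t ht).add ((hx' t ht).const_smul δ)
    exact (((((hβderiv t ht).mul (hGd t ht)).const_mul (δ ^ 2)).add
      (hzd.norm_sq.const_mul (1 / 2))).add ((hy t ht).norm_sq.const_mul _)).add
      (((hlam t ht).sub_const ls).norm_sq.const_mul _)
  obtain ⟨M, hM0, hM⟩ := exists_bound_of_hasDerivWithinAt_le_mul_one_add hEd hE0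
    (hεcont.norm.const_mul δ) (fun t _ => by positivity) (hεint.const_mul δ) (fun t ht => by
      have hβ := hβpos t ht
      have h1 : δ * β' t - β t ≤ 0 := by
        have := hscale t ht
        rw [le_div_iff₀ hδ] at this
        linarith
      have h2 : δ * (δ * β' t - β t) * G t ≤ 0 :=
        mul_nonpos_of_nonpos_of_nonneg (mul_nonpos_of_nonneg_of_nonpos hδ.le h1) (hG0 t)
      have h3 : 0 ≤ ⟪gradient f (x t), x t - xs⟫ - (f (x t) - f xs) := by
        have := hf_conv.inner_gradient_le_sub (hfd (x t)) xs
        rw [← neg_sub (x t) xs, inner_neg_right] at this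
        linarith
      have h4 : 0 ≤ δ * β t * (⟪gradient f (x t), x t - xs⟫ - (f (x t) - f xs)
          + σ / 2 * ‖A (x t - xs)‖ ^ 2) :=
        mul_nonneg (by positivity) (add_nonneg h3 (by positivity))
      have h5 : 0 ≤ δ * (δ * γ - 1) * ‖x' t‖ ^ 2 := by positivity
      have h6 : ‖z t‖ ≤ 1 + E t := by
        have h7 : 1 / 2 * ‖z t‖ ^ 2 ≤ E t := by
          have := hβG t ht
          have : 0 ≤ δ ^ 2 * (β t * G t) := by positivity
          have : 0 ≤ (δ * γ - 1) / 2 * ‖x t - xs‖ ^ 2 := by positivity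
          have : 0 ≤ δ / 2 * ‖lam t - ls‖ ^ 2 := by positivity
          simp only [hE]
          linarith
        nlinarith [sq_nonneg (‖z t‖ - 1)]
      have h8 : δ * ⟪ε t, z t⟫ ≤ δ * ‖ε t‖ * (1 + E t) := by
        rw [mul_assoc]
        gcongr
        exact (real_inner_le_norm _ _).trans (by gcongr)
      linarith)
  have hGM : ∀ t ∈ Ici t₀, G t ≤ M / δ ^ 2 / β t := fun t ht => by
    have h1 : δ ^ 2 * (β t * G t) ≤ M := by
      refine le_trans ?_ (hM t ht)
      simp only [hE]
      have : 0 ≤ (δ * γ - 1) / 2 * ‖x t - xs‖ ^ 2 := by positivity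
      have : 0 ≤ δ / 2 * ‖lam t - ls‖ ^ 2 := by positivity
      have : 0 ≤ 1 / 2 * ‖z t‖ ^ 2 := by positivity
      linarith
    rw [le_div_iff₀ (hβpos t ht), le_div_iff₀ (by positivity)]
    linarith
  refine ⟨M / δ ^ 2, √(2 / σ * (M / δ ^ 2)), by positivity, by positivity, fun t ht => ⟨?_, ?_⟩⟩
  · refine le_trans ?_ (hGM t ht)
    rw [hsaddle.lagr_eq, Lagr, hAy]
    have : 0 ≤ σ / 2 * ‖A (x t - xs)‖ ^ 2 := by positivity
    simp only [hG]
    linarith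
  · rw [← Real.sqrt_div (by positivity), hAy]
    refine Real.le_sqrt_of_sq_le ?_
    have h1 : σ / 2 * ‖A (x t - xs)‖ ^ 2 ≤ M / δ ^ 2 / β t :=
      le_trans (le_add_of_nonneg_left (hgap t)) (hGM t ht)
    calc ‖A (x t - xs)‖ ^ 2 = 2 / σ * (σ / 2 * ‖A (x t - xs)‖ ^ 2) := by field_simp
      _ ≤ 2 / σ * (M / δ ^ 2 / β t) := by gcongr
      _ = 2 / σ * (M / δ ^ 2) / β t := by ring
end
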